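/- (Proposition: ICE and ECE are weaker than FCE.) Let 𝓔 = (T, Ω, Act) be an extended transition system, a an agent, and ψ an effect. Suppose 𝓔 satisfies Full Causal Explainability: for every trace π ∈ Π(T) and every time point i with π,i ⊨ ψ, there exists T₀ ⊆ (2^Act)^ω such that T₀ = Cause(ψ, π′, i, Act) for every π′ ∈ Π(T) that is a-indistinguishable from π up to i. Then 𝓔 satisfies Internal Causal Explainability (the same condition with Act replaced by Act(a)) and External Causal Explainability (the same condition with Act replaced by Act ∖ Act(a)). -/

import Mathlib

/-- A transition system `T = (S, S₀, Δ, AP, Λ)`. -/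
structure TransSys (S AP : Type*) where
  init : Set S
  delta : S → Set S
  delta_nonempty : ∀ s, (delta s).Nonempty
  label : S → S → Set AP

namespace TransSys

variable {S AP : Type*}

/-- A path is an infinite sequence of states following the transition function. -/
def IsPath (T : TransSys S AP) (ρ : ℕ → S) : Prop :=
  ∀ i, ρ (i + 1) ∈ T.delta (ρ i)

/-- The trace of a path is the sequence of its edge labels. -/
def traceOf (T : TransSys S AP) (ρ : ℕ → S) : ℕ → Set AP :=
  fun i => T.label (ρ i) (ρ (i + 1))

/-- `Π(T)`: the traces of initial paths. -/
def Traces (T : TransSys S AP) : Set (ℕ → Set AP) :=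
  { π | ∃ ρ : ℕ → S, ρ 0 ∈ T.init ∧ T.IsPath ρ ∧ π = T.traceOf ρ }

end TransSys

variable {S AP AG : Type*}

/-- `π =_A π′` : agreement on `A` at every time point. -/
def agreeOn (A : Set AP) (π π' : ℕ → Set AP) : Prop :=
  ∀ i, π i ∩ A = π' i ∩ A

/-- `π|_A` : projection of a trace to `A`. -/
def restrictTo (A : Set AP) (π : ℕ → Set AP) : ℕ → Set AP :=
  fun i => π i ∩ A

/-- `π ⊕_A π′` : trace-wide symmetric difference restricted to `A`. -/
def symDiff (A : Set AP) (π π' : ℕ → Set AP) : Set (AP × ℕ) :=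
  { q | q.1 ∈ A ∧ q.1 ∈ (π q.2 \ π' q.2) ∪ (π' q.2 \ π q.2) }

/-- `π′ ≤^A_{base} π″` : `π′` is at least as similar to `base` as `π″`, over `A`. -/
def simLE (A : Set AP) (base π' π'' : ℕ → Set AP) : Prop :=
  symDiff A π' base ⊆ symDiff A π'' base

/-- An extended transition system `𝓔 = (T, Ω, Act)`. -/
structure ExtTransSys (S AP AG : Type*) extends TransSys S AP where
  obs : AG → Set AP
  actMap : AG → Set AP
  act_sub_obs : ∀ a, actMap a ⊆ obs a
  act_total : ∀ (s : S) (A : Set AP), A ⊆ (⋃ a, actMap a) →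
    ∃ s' ∈ delta s, label s s' ∩ (⋃ a, actMap a) = A

namespace ExtTransSys

/-- The set of all actions. -/
def Act (E : ExtTransSys S AP AG) : Set AP := ⋃ a, E.actMap a

/-- The temporal cause `Cause(ψ, π, i, A)` of effect `ψ` on trace `π` at time `i` over
actions `A`. -/
def Cause (E : ExtTransSys S AP AG) (ψ : (ℕ → Set AP) → ℕ → Prop)
    (π : ℕ → Set AP) (i : ℕ) (A : Set AP) : Set (ℕ → Set AP) :=
  { π' | (∀ j, π' j ⊆ A) ∧
      ∀ π'' ∈ E.toTransSys.Traces, simLE A π π'' π' → agreeOn (E.Act \ A) π π'' →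
        ψ π'' i }

/-- `π` and `π′` are `a`-indistinguishable up to time `i`. -/
def Indist (E : ExtTransSys S AP AG) (a : AG) (i : ℕ) (π π' : ℕ → Set AP) : Prop :=
  ∀ j ≤ i, π j ∩ E.obs a = π' j ∩ E.obs a

/-- Deterministic extended transition system: unique initial state and for every state and
action set exactly one matching successor. -/
def Deterministic (E : ExtTransSys S AP AG) : Prop :=
  (∃ s₀ : S, E.init = {s₀}) ∧
  ∀ (s : S) (A : Set AP), A ⊆ E.Act →
    ∃! s' : S, s' ∈ E.delta s ∧ E.label s s' ∩ E.Act = A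

end ExtTransSys

namespace ExtTransSys

/-- A trace over `A` belongs to the cause over `A` iff its completion by the remaining actions of
the base trace belongs to the cause over all actions. -/
theorem mem_Cause_iff_completion {E : ExtTransSys S AP AG} {ψ : (ℕ → Set AP) → ℕ → Prop}
    {π τ : ℕ → Set AP} {i : ℕ} {A : Set AP} (hA : A ⊆ E.Act) (hτ : ∀ j, τ j ⊆ A) :
    τ ∈ E.Cause ψ π i A ↔ (fun j => τ j ∪ (π j ∩ (E.Act \ A))) ∈ E.Cause ψ π i E.Act := by
  have key : ∀ π'', simLE E.Act π π'' (fun j => τ j ∪ (π j ∩ (E.Act \ A))) ↔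
      simLE A π π'' τ ∧ agreeOn (E.Act \ A) π π'' := by
    intro π''
    simp only [simLE, agreeOn, symDiff, Set.subset_def, Set.ext_iff, Prod.forall,
      Set.mem_ofPred_eq, Set.mem_union, Set.mem_inter_iff, Set.mem_sdiff] at hA hτ ⊢
    refine ⟨fun h => ⟨fun p j => ?_, fun j p => ?_⟩, fun ⟨h₁, h₂⟩ p j => ?_⟩
    · have := h p j; have := hA p; tauto
    · have := h p j; have := hτ j p; tauto
    · have := h₁ p j; have := h₂ j p; have := hA p; have := hτ j p; tauto
  constructor
  · rintro ⟨-, h⟩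
    refine ⟨fun j => Set.union_subset ((hτ j).trans hA) fun p hp => hp.2.1, ?_⟩
    intro π'' hπ'' hle _
    exact h π'' hπ'' ((key π'').1 hle).1 ((key π'').1 hle).2
  · rintro ⟨-, h⟩
    refine ⟨hτ, fun π'' hπ'' hle hag => h π'' hπ'' ((key π'').2 ⟨hle, hag⟩) ?_⟩
    simp [agreeOn]

/-- Causes are closed under moving closer to the base trace. -/
theorem mem_Cause_of_simLE {E : ExtTransSys S AP AG} {ψ : (ℕ → Set AP) → ℕ → Prop}
    {π σ τ : ℕ → Set AP} {i : ℕ} {A : Set AP} (hτ : τ ∈ E.Cause ψ π i A)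
    (hσ : ∀ j, σ j ⊆ A) (h : simLE A π σ τ) : σ ∈ E.Cause ψ π i A :=
  ⟨hσ, fun π'' hπ'' hle hag => hτ.2 π'' hπ'' (hle.trans h) hag⟩

/-- Inclusion of causes over all actions passes to every smaller set of actions. -/
theorem Cause_subset_of_Cause_Act_subset {E : ExtTransSys S AP AG}
    {ψ : (ℕ → Set AP) → ℕ → Prop} {π π' : ℕ → Set AP} {i : ℕ} {A : Set AP} (hA : A ⊆ E.Act)
    (h : E.Cause ψ π i E.Act ⊆ E.Cause ψ π' i E.Act) :
    E.Cause ψ π i A ⊆ E.Cause ψ π' i A := by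
  intro τ hτ
  have hτA := hτ.1
  rw [mem_Cause_iff_completion hA hτA] at hτ ⊢
  refine mem_Cause_of_simLE (h hτ)
    (fun j => Set.union_subset ((hτA j).trans hA) fun p hp => hp.2.1) ?_
  rintro ⟨p, j⟩
  have := @hτA j p
  simp only [symDiff, Set.mem_ofPred_eq, Set.mem_union, Set.mem_inter_iff, Set.mem_sdiff]
  tauto

/-- If the cause over all actions is the same on all traces indistinguishable from a trace, then
so is the cause over any smaller set of actions. -/
theorem exists_Cause_eq_of_subset_Act {E : ExtTransSys S AP AG} {a : AG}
    {ψ : (ℕ → Set AP) → ℕ → Prop} {π : ℕ → Set AP} {i : ℕ} {A T₀}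
    (hA : A ⊆ E.Act) (hπ : π ∈ E.toTransSys.Traces)
    (h : ∀ π' ∈ E.toTransSys.Traces, E.Indist a i π π' → T₀ = E.Cause ψ π' i E.Act) :
    ∃ T₁ : Set (ℕ → Set AP), (∀ τ ∈ T₁, ∀ j, τ j ⊆ A) ∧
      ∀ π' ∈ E.toTransSys.Traces, E.Indist a i π π' → T₁ = E.Cause ψ π' i A := by
  refine ⟨E.Cause ψ π i A, fun τ hτ => hτ.1, fun π' hπ' hind => ?_⟩
  have heq : E.Cause ψ π i E.Act = E.Cause ψ π' i E.Act :=
    (h π hπ fun _ _ => rfl).symm.trans (h π' hπ' hind)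
  exact (Cause_subset_of_Cause_Act_subset hA heq.subset).antisymm
    (Cause_subset_of_Cause_Act_subset hA heq.superset)

end ExtTransSys

/-- Full Causal Explainability implies both Internal and External Causal
Explainability. -/
theorem FCE_implies_ICE_and_ECE [Finite S] [Finite AP] [Finite AG]
    (E : ExtTransSys S AP AG) (a : AG) (ψ : (ℕ → Set AP) → ℕ → Prop)
    (hFCE : ∀ π ∈ E.toTransSys.Traces, ∀ i : ℕ, ψ π i →
      ∃ T₀ : Set (ℕ → Set AP), (∀ τ ∈ T₀, ∀ j, τ j ⊆ E.Act) ∧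
        ∀ π' ∈ E.toTransSys.Traces, E.Indist a i π π' → T₀ = E.Cause ψ π' i E.Act) :
    (∀ π ∈ E.toTransSys.Traces, ∀ i : ℕ, ψ π i →
      ∃ T₀ : Set (ℕ → Set AP), (∀ τ ∈ T₀, ∀ j, τ j ⊆ E.actMap a) ∧
        ∀ π' ∈ E.toTransSys.Traces, E.Indist a i π π' →
          T₀ = E.Cause ψ π' i (E.actMap a)) ∧
    (∀ π ∈ E.toTransSys.Traces, ∀ i : ℕ, ψ π i →
      ∃ T₀ : Set (ℕ → Set AP), (∀ τ ∈ T₀, ∀ j, τ j ⊆ E.Act \ E.actMap a) ∧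
        ∀ π' ∈ E.toTransSys.Traces, E.Indist a i π π' →
          T₀ = E.Cause ψ π' i (E.Act \ E.actMap a)) := by
  refine ⟨fun π hπ i hψ => ?_, fun π hπ i hψ => ?_⟩ <;> obtain ⟨T₀, -, h⟩ := hFCE π hπ i hψ
  · exact ExtTransSys.exists_Cause_eq_of_subset_Act (Set.subset_iUnion E.actMap a) hπ h
  · exact ExtTransSys.exists_Cause_eq_of_subset_Act Set.sdiff_subset hπ h
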